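/- Fix (p,q) ∈ ℤ² and suppose that the ℂ-vector spaces H_{BC}^{p,q}, H_A^{p,q}, H_{d'}^{p,q}, H_{d''}^{p,q}, together with S := (Im d' ∩ Im d'' ∩ A^{p,q})/(Im d'd'' ∩ A^{p,q}) and U := (ker d'd'' ∩ A^{p,q})/((ker d' + ker d'') ∩ A^{p,q}), are all finite dimensional. Then dim_ℂ H_{BC}^{p,q} + dim_ℂ H_A^{p,q} = dim_ℂ H_{d'}^{p,q} + dim_ℂ H_{d''}^{p,q} + dim_ℂ U + dim_ℂ S; in particular dim_ℂ H_{BC}^{p,q} + dim_ℂ H_A^{p,q} ≥ dim_ℂ H_{d'}^{p,q} + dim_ℂ H_{d''}^{p,q}. -/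

import Mathlib

open Submodule

/-- A double complex of complex vector spaces, realized as an internally bigraded
module `W = ⊕_{p,q} A p q` together with global differentials `d'`, `d''` of
bidegrees `(1,0)` and `(0,1)` satisfying `d'∘d' = 0`, `d''∘d'' = 0` and
`d'∘d'' + d''∘d' = 0`. -/
structure BiComplex (W : Type*) [AddCommGroup W] [Module ℂ W] where
  A : ℤ → ℤ → Submodule ℂ W
  d' : W →ₗ[ℂ] W
  d'' : W →ₗ[ℂ] W
  internal : DirectSum.IsInternal (fun pq : ℤ × ℤ => A pq.1 pq.2)
  map_d' : ∀ p q : ℤ, (A p q).map d' ≤ A (p + 1) q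
  map_d'' : ∀ p q : ℤ, (A p q).map d'' ≤ A p (q + 1)
  d'_sq : d' ∘ₗ d' = 0
  d''_sq : d'' ∘ₗ d'' = 0
  anticomm : d' ∘ₗ d'' + d'' ∘ₗ d' = 0

namespace BiComplex

variable {W : Type*} [AddCommGroup W] [Module ℂ W] (C : BiComplex W)

/-- `ker d' ∩ A^{p,q}` : the kernel of `d' : A^{p,q} → A^{p+1,q}`. -/
def kerd' (p q : ℤ) : Submodule ℂ W := LinearMap.ker C.d' ⊓ C.A p q

/-- `ker d'' ∩ A^{p,q}` : the kernel of `d'' : A^{p,q} → A^{p,q+1}`. -/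
def kerd'' (p q : ℤ) : Submodule ℂ W := LinearMap.ker C.d'' ⊓ C.A p q

/-- `Im d' ∩ A^{p,q} = d'(A^{p-1,q})`. -/
def imd' (p q : ℤ) : Submodule ℂ W := (C.A (p - 1) q).map C.d'

/-- `Im d'' ∩ A^{p,q} = d''(A^{p,q-1})`. -/
def imd'' (p q : ℤ) : Submodule ℂ W := (C.A p (q - 1)).map C.d''

/-- `Im d'd'' ∩ A^{p,q} = (d'∘d'')(A^{p-1,q-1})`. -/
def imd'd'' (p q : ℤ) : Submodule ℂ W := (C.A (p - 1) (q - 1)).map (C.d' ∘ₗ C.d'')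

/-- `ker d'd'' ∩ A^{p,q}` : the kernel of `d'∘d'' : A^{p,q} → A^{p+1,q+1}`. -/
def kerd'd'' (p q : ℤ) : Submodule ℂ W := LinearMap.ker (C.d' ∘ₗ C.d'') ⊓ C.A p q

/-- The `d'd''`-lemma at `(p,q)`:
`Im d' ∩ ker d'' ∩ A^{p,q} = ker d' ∩ Im d'' ∩ A^{p,q} = Im d'd'' ∩ A^{p,q}`. -/
def DDLemmaAt (p q : ℤ) : Prop :=
  C.imd' p q ⊓ C.kerd'' p q = C.imd'd'' p q ∧ C.kerd' p q ⊓ C.imd'' p q = C.imd'd'' p q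

/-- The total-degree piece `A^k = ⊕_{p+q=k} A^{p,q}`. -/
def Atot (k : ℤ) : Submodule ℂ W := ⨆ p : ℤ, C.A p (k - p)

/-- The total differential `d = d' + d''`. -/
def dtot : W →ₗ[ℂ] W := C.d' + C.d''

/-- `ker d ∩ A^k` : the kernel of `d : A^k → A^{k+1}`. -/
def kerdTot (k : ℤ) : Submodule ℂ W := LinearMap.ker C.dtot ⊓ C.Atot k

/-- `Im d ∩ A^k = d(A^{k-1})`. -/
def imdTot (k : ℤ) : Submodule ℂ W := (C.Atot (k - 1)).map C.dtot

/-- `ker d' ∩ ker d'' ∩ A^k = ⊕_{p+q=k} (ker d' ∩ ker d'' ∩ A^{p,q})`. -/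
def kerd'kerd''Tot (k : ℤ) : Submodule ℂ W :=
  ⨆ p : ℤ, (C.kerd' p (k - p) ⊓ C.kerd'' p (k - p))

/-- `Im d'd'' ∩ A^k = ⊕_{p+q=k} (Im d'd'' ∩ A^{p,q})`. -/
def imd'd''Tot (k : ℤ) : Submodule ℂ W := ⨆ p : ℤ, C.imd'd'' p (k - p)

/-- `ker d'd'' ∩ A^k = ⊕_{p+q=k} (ker d'd'' ∩ A^{p,q})`. -/
def kerd'd''Tot (k : ℤ) : Submodule ℂ W := ⨆ p : ℤ, C.kerd'd'' p (k - p)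

/-- `Im d' ∩ A^k = ⊕_{p+q=k} (Im d' ∩ A^{p,q})`. -/
def imd'Tot (k : ℤ) : Submodule ℂ W := ⨆ p : ℤ, C.imd' p (k - p)

/-- `Im d'' ∩ A^k = ⊕_{p+q=k} (Im d'' ∩ A^{p,q})`. -/
def imd''Tot (k : ℤ) : Submodule ℂ W := ⨆ p : ℤ, C.imd'' p (k - p)

/-- The double complex is totally bounded: `A^{p,q} = 0` for `|p| > N` or `|q| > N`. -/
def TotallyBounded : Prop :=
  ∃ N : ℕ, ∀ p q : ℤ, ((N : ℤ) < |p| ∨ (N : ℤ) < |q|) → C.A p q = ⊥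

end BiComplex

/-- The quotient vector space `S / T` of a submodule `S` by (the trace of) a
submodule `T ≤ S`. -/
abbrev quotSub {W : Type*} [AddCommGroup W] [Module ℂ W] (S T : Submodule ℂ W) :=
  S ⧸ (Submodule.comap S.subtype T)

namespace quotSub

variable {W : Type*} [AddCommGroup W] [Module ℂ W]

/-- Dimensions of subquotients are additive along a chain `T ≤ M ≤ S`. -/
theorem rank_add_rank {S M T : Submodule ℂ W} (hTM : T ≤ M) (hMS : M ≤ S) :
    Module.rank ℂ (quotSub S M) + Module.rank ℂ (quotSub M T) =
      Module.rank ℂ (quotSub S T) := by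
  let f : quotSub S T →ₗ[ℂ] quotSub S M := Submodule.factor (Submodule.comap_mono hTM)
  let g : quotSub M T →ₗ[ℂ] quotSub S T :=
    Submodule.mapQ _ _ (Submodule.inclusion hMS) fun _ hx => hx
  have hf : Function.Surjective f := Submodule.factor_surjective _
  have hg : Function.Injective g := by
    rw [← LinearMap.ker_eq_bot, LinearMap.ker_eq_bot']
    intro x hx
    induction x using Submodule.Quotient.induction_on with
    | H x =>
      rw [Submodule.Quotient.mk_eq_zero]
      exact (Submodule.Quotient.mk_eq_zero (Submodule.comap S.subtype T)).1 hx
  have hfg : LinearMap.range g = LinearMap.ker f := by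
    ext x
    induction x using Submodule.Quotient.induction_on with
    | H x =>
      constructor
      · rintro ⟨y, hy⟩
        rw [← hy]
        induction y using Submodule.Quotient.induction_on with
        | H y => exact (Submodule.Quotient.mk_eq_zero _).2 y.2
      · intro hx
        have hxM : (x : W) ∈ M :=
          (Submodule.Quotient.mk_eq_zero (Submodule.comap S.subtype M)).1 hx
        exact ⟨Submodule.Quotient.mk ⟨x, hxM⟩, rfl⟩
  rw [LinearMap.rank_eq_of_surjective hf, ← hfg, (LinearEquiv.ofInjective g hg).rank_eq]

/-- The second isomorphism theorem, where `quotSub S T` is `S ⧸ (S ⊓ T)`. -/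
theorem rank_sup (S T : Submodule ℂ W) :
    Module.rank ℂ (quotSub (S ⊔ T) T) = Module.rank ℂ (quotSub S T) := by
  rw [← (LinearMap.quotientInfEquivSupQuotient S T).rank_eq, Submodule.comap_subtype_self,
    top_inf_eq]

theorem rank_inf (S T : Submodule ℂ W) :
    Module.rank ℂ (quotSub S (S ⊓ T)) = Module.rank ℂ (quotSub S T) := by
  refine (Submodule.quotEquivOfEq _ _ ?_).rank_eq
  rw [Submodule.comap_inf, Submodule.comap_subtype_self, top_inf_eq]

/-- Inclusion-exclusion for the dimensions of subquotients. -/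
theorem rank_inf_add_rank_sup {K₁ K₂ I₁ I₂ : Submodule ℂ W} (h₁ : I₁ ≤ K₁) (h₂ : I₂ ≤ K₂) :
    Module.rank ℂ (quotSub (K₁ ⊓ K₂) (I₁ ⊓ I₂)) +
        Module.rank ℂ (quotSub (K₁ ⊔ K₂) (I₁ ⊔ I₂)) =
      Module.rank ℂ (quotSub K₁ I₁) + Module.rank ℂ (quotSub K₂ I₂) := by
  have hinf := rank_add_rank (inf_le_inf_right I₂ h₁) (inf_le_inf_left K₁ h₂)
  have hsup := rank_add_rank (sup_le_sup_right h₁ I₂) (sup_le_sup_left h₂ K₁)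
  have hK₁ := rank_add_rank (S := K₁) (M := (K₁ ⊓ I₂) ⊔ I₁) le_sup_right
    (sup_le inf_le_left h₁)
  have hK₂ := rank_add_rank (S := K₂) (M := (K₁ ⊓ K₂) ⊔ I₂) le_sup_right
    (sup_le inf_le_right h₂)
  -- the graded pieces on the side of `K₁`
  have e₁ : Module.rank ℂ (quotSub ((K₁ ⊓ I₂) ⊔ I₁) I₁) =
      Module.rank ℂ (quotSub (K₁ ⊓ I₂) (I₁ ⊓ I₂)) := by
    rw [rank_sup, ← rank_inf (K₁ ⊓ I₂) I₁, inf_right_comm, inf_eq_right.2 h₁]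
  have e₂ : Module.rank ℂ (quotSub (K₁ ⊔ I₂) (I₁ ⊔ I₂)) =
      Module.rank ℂ (quotSub K₁ ((K₁ ⊓ I₂) ⊔ I₁)) := by
    have hs : K₁ ⊔ I₂ = K₁ ⊔ (I₁ ⊔ I₂) := by rw [← sup_assoc, sup_eq_left.2 h₁]
    have hi : K₁ ⊓ (I₁ ⊔ I₂) = (K₁ ⊓ I₂) ⊔ I₁ := by
      rw [inf_comm, sup_inf_assoc_of_le _ h₁, sup_comm, inf_comm]
    rw [hs, rank_sup, ← rank_inf, hi]
  -- the graded pieces on the side of `K₂`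
  have e₃ : Module.rank ℂ (quotSub ((K₁ ⊓ K₂) ⊔ I₂) I₂) =
      Module.rank ℂ (quotSub (K₁ ⊓ K₂) (K₁ ⊓ I₂)) := by
    rw [rank_sup, ← rank_inf (K₁ ⊓ K₂) I₂, inf_assoc, inf_eq_right.2 h₂]
  have e₄ : Module.rank ℂ (quotSub (K₁ ⊔ K₂) (K₁ ⊔ I₂)) =
      Module.rank ℂ (quotSub K₂ ((K₁ ⊓ K₂) ⊔ I₂)) := by
    have hs : K₁ ⊔ K₂ = K₂ ⊔ (K₁ ⊔ I₂) := by
      rw [sup_left_comm, sup_eq_left.2 h₂]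
    have hi : K₂ ⊓ (K₁ ⊔ I₂) = (K₁ ⊓ K₂) ⊔ I₂ := by
      rw [inf_comm, sup_comm K₁, sup_inf_assoc_of_le _ h₂, sup_comm]
    rw [hs, rank_sup, ← rank_inf, hi]
  rw [← hinf, ← hsup, ← hK₁, ← hK₂, e₁, e₂, e₃, e₄]
  ring

end quotSub

namespace BiComplex

variable {W : Type*} [AddCommGroup W] [Module ℂ W] (C : BiComplex W) (p q : ℤ)

theorem d'_d'_apply (x : W) : C.d' (C.d' x) = 0 := LinearMap.congr_fun C.d'_sq x

theorem d''_d''_apply (x : W) : C.d'' (C.d'' x) = 0 := LinearMap.congr_fun C.d''_sq x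

theorem d'_d''_apply (x : W) : C.d' (C.d'' x) = -C.d'' (C.d' x) :=
  eq_neg_of_add_eq_zero_left (LinearMap.congr_fun C.anticomm x)

theorem d'_mem {p q : ℤ} {x : W} (hx : x ∈ C.A (p - 1) q) : C.d' x ∈ C.A p q := by
  simpa using C.map_d' _ _ (Submodule.mem_map_of_mem hx)

theorem d''_mem {p q : ℤ} {x : W} (hx : x ∈ C.A p (q - 1)) : C.d'' x ∈ C.A p q := by
  simpa using C.map_d'' _ _ (Submodule.mem_map_of_mem hx)

theorem imd'_le_kerd' : C.imd' p q ≤ C.kerd' p q := by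
  rintro _ ⟨x, hx, rfl⟩
  exact ⟨C.d'_d'_apply x, C.d'_mem hx⟩

theorem imd''_le_kerd'' : C.imd'' p q ≤ C.kerd'' p q := by
  rintro _ ⟨x, hx, rfl⟩
  exact ⟨C.d''_d''_apply x, C.d''_mem hx⟩

theorem imd'd''_le_inf : C.imd'd'' p q ≤ C.imd' p q ⊓ C.imd'' p q := by
  rintro _ ⟨x, hx, rfl⟩
  refine ⟨⟨C.d'' x, C.d''_mem hx, rfl⟩, ⟨-C.d' x, neg_mem (C.d'_mem hx), ?_⟩⟩
  simp [C.d'_d''_apply]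

theorem sup_le_kerd'd'' : C.kerd' p q ⊔ C.kerd'' p q ≤ C.kerd'd'' p q := by
  refine sup_le ?_ ?_ <;> rintro x ⟨hx, hxA⟩ <;> refine ⟨?_, hxA⟩ <;>
    rw [SetLike.mem_coe, LinearMap.mem_ker] at hx ⊢
  · simp [C.d'_d''_apply, hx]
  · simp [hx]

end BiComplex

/-- If the spaces `H_BC^{p,q}`, `H_A^{p,q}`, `H_{d'}^{p,q}`,
`H_{d''}^{p,q}`, `S = (Im d' ∩ Im d'' ∩ A^{p,q})/(Im d'd'' ∩ A^{p,q})` and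
`U = (ker d'd'' ∩ A^{p,q})/((ker d' + ker d'') ∩ A^{p,q})` are all finite
dimensional, then `dim H_BC + dim H_A = dim H_{d'} + dim H_{d''} + dim U + dim S`;
in particular `dim H_BC + dim H_A ≥ dim H_{d'} + dim H_{d''}`. -/
theorem bicomplex_dim_BC_add_A
    {W : Type*} [AddCommGroup W] [Module ℂ W] (C : BiComplex W) (p q : ℤ)
    (hBC : FiniteDimensional ℂ
      (quotSub (C.kerd' p q ⊓ C.kerd'' p q) (C.imd'd'' p q)))
    (hA : FiniteDimensional ℂ
      (quotSub (C.kerd'd'' p q) (C.imd' p q ⊔ C.imd'' p q)))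
    (hd' : FiniteDimensional ℂ (quotSub (C.kerd' p q) (C.imd' p q)))
    (hd'' : FiniteDimensional ℂ (quotSub (C.kerd'' p q) (C.imd'' p q)))
    (hS : FiniteDimensional ℂ
      (quotSub (C.imd' p q ⊓ C.imd'' p q) (C.imd'd'' p q)))
    (hU : FiniteDimensional ℂ
      (quotSub (C.kerd'd'' p q) (C.kerd' p q ⊔ C.kerd'' p q))) :
    Module.finrank ℂ (quotSub (C.kerd' p q ⊓ C.kerd'' p q) (C.imd'd'' p q)) +
        Module.finrank ℂ (quotSub (C.kerd'd'' p q) (C.imd' p q ⊔ C.imd'' p q)) =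
      Module.finrank ℂ (quotSub (C.kerd' p q) (C.imd' p q)) +
        Module.finrank ℂ (quotSub (C.kerd'' p q) (C.imd'' p q)) +
        Module.finrank ℂ (quotSub (C.kerd'd'' p q) (C.kerd' p q ⊔ C.kerd'' p q)) +
        Module.finrank ℂ (quotSub (C.imd' p q ⊓ C.imd'' p q) (C.imd'd'' p q)) ∧
    Module.finrank ℂ (quotSub (C.kerd' p q ⊓ C.kerd'' p q) (C.imd'd'' p q)) +
        Module.finrank ℂ (quotSub (C.kerd'd'' p q) (C.imd' p q ⊔ C.imd'' p q)) ≥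
      Module.finrank ℂ (quotSub (C.kerd' p q) (C.imd' p q)) +
        Module.finrank ℂ (quotSub (C.kerd'' p q) (C.imd'' p q)) := by
  have hBC' := quotSub.rank_add_rank (C.imd'd''_le_inf p q)
    (inf_le_inf (C.imd'_le_kerd' p q) (C.imd''_le_kerd'' p q))
  have hA' := quotSub.rank_add_rank
    (sup_le_sup (C.imd'_le_kerd' p q) (C.imd''_le_kerd'' p q)) (C.sup_le_kerd'd'' p q)
  have hd := quotSub.rank_inf_add_rank_sup (C.imd'_le_kerd' p q) (C.imd''_le_kerd'' p q)
  have hrank :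
      Module.rank ℂ (quotSub (C.kerd' p q ⊓ C.kerd'' p q) (C.imd'd'' p q)) +
          Module.rank ℂ (quotSub (C.kerd'd'' p q) (C.imd' p q ⊔ C.imd'' p q)) =
        Module.rank ℂ (quotSub (C.kerd' p q) (C.imd' p q)) +
          Module.rank ℂ (quotSub (C.kerd'' p q) (C.imd'' p q)) +
          Module.rank ℂ (quotSub (C.kerd'd'' p q) (C.kerd' p q ⊔ C.kerd'' p q)) +
          Module.rank ℂ (quotSub (C.imd' p q ⊓ C.imd'' p q) (C.imd'd'' p q)) := by
    rw [← hBC', ← hA', ← hd]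
    ring
  simp only [← Module.finrank_eq_rank] at hrank
  norm_cast at hrank
  exact ⟨hrank, by omega⟩
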